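/- Define functions A_d, B_d: ℤ_{≥2} → ℤ_{≥2} recursively as follows: A_2(σ) = 4σ + 2; given A_d for d ≥ 2, set ψ^{(d)}_1(ε) = 2A_d((d+1)ε), ψ^{(d)}_i(ε) = 2A_d((d+1)·(ψ^{(d)}_{i−1})^{ε}(ε)) for 2 ≤ i ≤ d−1, φ^{(d)}_i(ε) = (ψ^{(d)}_i)^{ε}(ε), B_d = φ^{(d)}_1 ∘ φ^{(d)}_2 ∘ ⋯ ∘ φ^{(d)}_{d−1}, and A_{d+1}(σ) = B_d(d^{2^{B_d(3σ+4)}}). Then for every d ≥ 2 and every σ ≥ 2, A_d(σ) ≤ (d+1)↑^{d²−d−1}((d+1)^σ) and B_d(σ) ≤ (d+1)↑^{d²+d−2}((d+1)^σ). -/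

import Mathlib

/-- Knuth's up-arrow `knuth a k b = a ↑^k b`, with `a ↑^1 b = a ^ b`,
`a ↑^(k+1) 1 = a` and `a ↑^(k+1) (b+1) = a ↑^k (a ↑^(k+1) b)`. -/
def knuth (a : ℕ) : ℕ → ℕ → ℕ
  | 0, b => a ^ b
  | 1, b => a ^ b
  | _+2, 0 => 1
  | _+2, 1 => a
  | k+2, b+2 => knuth a (k+1) (knuth a (k+2) (b+1))
  termination_by k b => (k, b)

/-- `psiA A d i` is the function `ψ^{(d)}_i`: `ψ^{(d)}_1 ε = 2 A ((d+1) ε)` and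
`ψ^{(d)}_{i+1} ε = 2 A ((d+1) · (ψ^{(d)}_i)^[ε] ε)` (index `0` is an auxiliary identity). -/
def psiA (A : ℕ → ℕ) (d : ℕ) : ℕ → ℕ → ℕ
  | 0, ε => ε
  | i+1, ε => 2 * A ((d + 1) * ((psiA A d i)^[ε] ε))

/-- `chainA A d m σ = φ^{(d)}_1 (φ^{(d)}_2 (⋯ (φ^{(d)}_m σ)))`
where `φ^{(d)}_i ε = (ψ^{(d)}_i)^[ε] ε`. -/
def chainA (A : ℕ → ℕ) (d : ℕ) : ℕ → ℕ → ℕ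
  | 0, σ => σ
  | m+1, σ => chainA A d m ((psiA A d (m+1))^[σ] σ)

/-- The recursively defined functions `A_d`: `A_2 σ = 4σ+2` and
`A_{d+1} σ = B_d (d ^ (2 ^ B_d (3σ+4)))` where `B_d = chainA A_d d (d-1)`. -/
def Afun : ℕ → ℕ → ℕ
  | 0, σ => 4 * σ + 2
  | 1, σ => 4 * σ + 2
  | 2, σ => 4 * σ + 2
  | d+3, σ =>
    chainA (Afun (d + 2)) (d + 2) (d + 1)
      ((d + 2) ^ (2 ^ (chainA (Afun (d + 2)) (d + 2) (d + 1) (3 * σ + 4))))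

/-- The functions `B_d = φ^{(d)}_1 ∘ ⋯ ∘ φ^{(d)}_{d-1}` built from `A_d`. -/
def Bfun (d : ℕ) : ℕ → ℕ := chainA (Afun d) d (d - 1)

theorem knuth_one_left (a b : ℕ) : knuth a 1 b = a ^ b := by
  simp [knuth]

theorem knuth_zero_right (a n : ℕ) : knuth a n 0 = 1 := by
  match n with
  | 0 => simp [knuth]
  | 1 => simp [knuth]
  | n + 2 => simp [knuth]

theorem knuth_one_right (a n : ℕ) : knuth a n 1 = a := by
  match n with
  | 0 => simp [knuth]
  | 1 => simp [knuth]
  | n + 2 => simp [knuth]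

theorem knuth_succ_succ (a n b : ℕ) :
    knuth a (n + 2) (b + 1) = knuth a (n + 1) (knuth a (n + 2) b) := by
  cases b with
  | zero => rw [knuth_zero_right, zero_add, knuth_one_right, knuth_one_right]
  | succ b => rw [knuth]

section Knuth

variable {a : ℕ}

theorem lt_knuth (ha : 2 ≤ a) (n x : ℕ) : x < knuth a (n + 1) x := by
  induction n generalizing x with
  | zero => rw [zero_add, knuth_one_left]; exact Nat.lt_pow_self ha
  | succ n ih =>
    induction x with
    | zero => rw [knuth_zero_right]; exact one_pos
    | succ x ihx =>
      rw [knuth_succ_succ]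
      exact lt_of_le_of_lt ihx (ih _)

theorem knuth_monotone (ha : 2 ≤ a) (n : ℕ) : Monotone (knuth a (n + 1)) := by
  cases n with
  | zero =>
    intro x y h
    rw [zero_add, knuth_one_left, knuth_one_left]
    exact Nat.pow_le_pow_right (by lia) h
  | succ n =>
    refine monotone_nat_of_le_succ fun x => ?_
    rw [knuth_succ_succ]
    exact (lt_knuth ha n _).le

theorem knuth_le_knuth_succ_level (ha : 2 ≤ a) (n x : ℕ) :
    knuth a (n + 1) x ≤ knuth a (n + 2) x := by
  cases x with
  | zero => rw [knuth_zero_right, knuth_zero_right]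
  | succ x =>
    rw [knuth_succ_succ]
    exact knuth_monotone ha n (lt_knuth ha (n + 1) x)

theorem knuth_le_knuth_level (ha : 2 ≤ a) {m n : ℕ} (h : m ≤ n) (x : ℕ) :
    knuth a (m + 1) x ≤ knuth a (n + 1) x :=
  monotone_nat_of_le_succ (f := fun n => knuth a (n + 1) x)
    (fun n => knuth_le_knuth_succ_level ha n x) h

theorem pow_le_knuth (ha : 2 ≤ a) (n x : ℕ) : a ^ x ≤ knuth a (n + 1) x := by
  have h := knuth_le_knuth_level ha (Nat.zero_le n) x
  rwa [zero_add, knuth_one_left] at h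

theorem knuth_le_knuth_base {b : ℕ} (ha : 2 ≤ a) (hab : a ≤ b) (n x : ℕ) :
    knuth a (n + 1) x ≤ knuth b (n + 1) x := by
  induction n generalizing x with
  | zero =>
    rw [zero_add, knuth_one_left, knuth_one_left]
    exact Nat.pow_le_pow_left hab x
  | succ n ih =>
    induction x with
    | zero => rw [knuth_zero_right, knuth_zero_right]
    | succ x ihx =>
      rw [knuth_succ_succ, knuth_succ_succ]
      exact (knuth_monotone ha n ihx).trans (ih _)

theorem mul_le_knuth (ha : 2 ≤ a) (n x : ℕ) (hx : 1 ≤ x) : a * x ≤ knuth a (n + 1) x := by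
  refine le_trans ?_ (pow_le_knuth ha n x)
  obtain ⟨y, rfl⟩ : ∃ y, x = y + 1 := ⟨x - 1, by lia⟩
  rw [pow_succ']
  exact Nat.mul_le_mul_left a (Nat.lt_pow_self ha)

theorem iterate_knuth_apply_knuth (n j x : ℕ) :
    (knuth a (n + 1))^[j] (knuth a (n + 2) x) = knuth a (n + 2) (x + j) := by
  induction j with
  | zero => rfl
  | succ j ih => rw [Function.iterate_succ_apply', ih, ← add_assoc, knuth_succ_succ]

theorem iterate_knuth_le (ha : 2 ≤ a) (n j x : ℕ) :
    (knuth a (n + 1))^[j] x ≤ knuth a (n + 2) (x + j) := by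
  rw [← iterate_knuth_apply_knuth]
  exact (knuth_monotone ha n).iterate j (lt_knuth ha _ x).le

theorem five_mul_add_four_le (ha : 3 ≤ a) (n : ℕ) {x : ℕ} (hx : 2 ≤ x) :
    5 * x + 4 ≤ (knuth a (n + 1))^[2] x := by
  have ha' : 2 ≤ a := by lia
  have h1 := mul_le_knuth ha' n x (by lia)
  have h2 := mul_le_knuth ha' n (knuth a (n + 1) x)
    (lt_of_le_of_lt (Nat.zero_le x) (lt_knuth ha' n x))
  change 5 * x + 4 ≤ knuth a (n + 1) (knuth a (n + 1) x)
  nlinarith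

end Knuth

theorem iterate_le_iterate_of_two_le {f g : ℕ → ℕ} (hg : Monotone g)
    (hf : ∀ x, 2 ≤ x → 2 ≤ f x) (hfg : ∀ x, 2 ≤ x → f x ≤ g x) (j : ℕ) {x : ℕ} (hx : 2 ≤ x) :
    2 ≤ f^[j] x ∧ f^[j] x ≤ g^[j] x := by
  induction j with
  | zero => exact ⟨hx, le_rfl⟩
  | succ j ih =>
    rw [Function.iterate_succ_apply', Function.iterate_succ_apply']
    exact ⟨hf _ ih.1, (hfg _ ih.1).trans (hg ih.2)⟩

section Chain

variable {A : ℕ → ℕ} {d : ℕ}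

theorem two_le_psiA (hA : ∀ x, 1 ≤ A x) (i : ℕ) {x : ℕ} (hx : 2 ≤ x) : 2 ≤ psiA A d i x := by
  cases i with
  | zero => exact hx
  | succ i =>
    rw [psiA]
    have := hA ((d + 1) * (psiA A d i)^[x] x)
    lia

theorem two_le_iterate_psiA (hA : ∀ x, 1 ≤ A x) (i j : ℕ) {x : ℕ} (hx : 2 ≤ x) :
    2 ≤ (psiA A d i)^[j] x := by
  induction j with
  | zero => exact hx
  | succ j ih =>
    rw [Function.iterate_succ_apply']
    exact two_le_psiA hA i ih

theorem two_le_chainA (hA : ∀ x, 1 ≤ A x) (m : ℕ) {x : ℕ} (hx : 2 ≤ x) :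
    2 ≤ chainA A d m x := by
  induction m generalizing x with
  | zero => exact hx
  | succ m ih => exact ih (two_le_iterate_psiA hA _ _ hx)

theorem two_mul_le_iterate_knuth {k : ℕ} (hd : 2 ≤ d)
    (hle : ∀ x, 2 ≤ x → A x ≤ knuth (d + 1) (k + 1) ((d + 1) ^ x)) {x : ℕ} (hx : 2 ≤ x) :
    2 * A ((d + 1) * x) ≤ (knuth (d + 1) (k + 1))^[4] x := by
  have ha : 2 ≤ d + 1 := by lia
  have hmono := knuth_monotone ha k
  set K := knuth (d + 1) (k + 1)
  have h1 : A ((d + 1) * x) ≤ K (K (K x)) :=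
    (hle _ (by nlinarith)).trans
      (hmono ((pow_le_knuth ha k _).trans (hmono (mul_le_knuth ha k x (by lia)))))
  have h2 := mul_le_knuth ha k (K (K (K x))) (lt_of_le_of_lt (Nat.zero_le _) (lt_knuth ha k _))
  change _ ≤ K (K (K (K x)))
  refine le_trans ?_ h2
  gcongr

theorem iterate_le_knuth_succ_level {f : ℕ → ℕ} {a n : ℕ} (ha : 2 ≤ a)
    (hf : ∀ x, 2 ≤ x → 2 ≤ f x)
    (hle : ∀ x, 2 ≤ x → f x ≤ (knuth a (n + 1))^[4] x) {x : ℕ} (hx : 2 ≤ x) :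
    f^[x] x ≤ knuth a (n + 2) (5 * x) := by
  have h := (iterate_le_iterate_of_two_le ((knuth_monotone ha n).iterate 4) hf hle x hx).2
  rw [← Function.iterate_mul] at h
  refine h.trans ((iterate_knuth_le ha n _ x).trans_eq ?_)
  congr 1
  ring

theorem psiA_succ_le {k : ℕ} (hd : 2 ≤ d) (hA : ∀ x, 1 ≤ A x)
    (hle : ∀ x, 2 ≤ x → A x ≤ knuth (d + 1) (k + 1) ((d + 1) ^ x)) (i : ℕ) {x : ℕ}
    (hx : 2 ≤ x) : psiA A d (i + 1) x ≤ (knuth (d + 1) (k + i + 1))^[4] x := by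
  have ha : 2 ≤ d + 1 := by lia
  induction i generalizing x with
  | zero =>
    have hid : psiA A d 0 = id := rfl
    rw [psiA, hid, Function.iterate_id]
    exact two_mul_le_iterate_knuth hd hle hx
  | succ i ih =>
    rw [psiA]
    have hφ := iterate_le_knuth_succ_level ha
      (fun y hy => two_le_psiA (d := d) hA (i + 1) hy) (fun y hy => ih hy) hx
    refine (two_mul_le_iterate_knuth hd hle (two_le_iterate_psiA hA _ _ hx)).trans ?_
    refine ((knuth_monotone ha k).iterate 4 hφ).trans ?_
    refine ((knuth_monotone ha k).iterate_le_of_le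
      (fun y => knuth_le_knuth_level ha (Nat.le_add_right k i) y) 4 _).trans ?_
    rw [iterate_knuth_apply_knuth]
    refine (knuth_monotone ha (k + i + 1)
      (five_mul_add_four_le (a := d + 1) (by lia) (k + i + 1) hx)).trans ?_
    exact (lt_knuth ha (k + i + 1) _).le

theorem chainA_le_iterate_knuth {k : ℕ} (hd : 2 ≤ d) (hA : ∀ x, 1 ≤ A x)
    (hle : ∀ x, 2 ≤ x → A x ≤ knuth (d + 1) (k + 1) ((d + 1) ^ x)) (m : ℕ) {x : ℕ}
    (hx : 2 ≤ x) : chainA A d m x ≤ (knuth (d + 1) (k + m + 1))^[3 * m] x := by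
  have ha : 2 ≤ d + 1 := by lia
  induction m generalizing x with
  | zero => exact le_rfl
  | succ m ih =>
    rw [chainA]
    refine (ih (two_le_iterate_psiA hA _ _ hx)).trans ?_
    refine ((knuth_monotone ha _).iterate_le_of_le
      (fun y => knuth_le_knuth_succ_level ha (k + m) y) _ _).trans ?_
    rw [mul_add, Function.iterate_add_apply]
    refine (knuth_monotone ha (k + m + 1)).iterate _ ?_
    refine (iterate_le_knuth_succ_level ha (fun y hy => two_le_psiA hA _ hy)
      (fun y hy => psiA_succ_le hd hA hle m hy) hx).trans ?_
    refine knuth_monotone ha (k + m + 1) ?_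
    exact le_trans (by lia) (five_mul_add_four_le (by lia) (k + m + 1) hx)

theorem add_three_mul_le_pow (hd : 2 ≤ d) {x : ℕ} (hx : 2 ≤ x) :
    x + 3 * (d - 1) ≤ (d + 1) ^ x := by
  induction x, hx using Nat.le_induction with
  | base =>
    obtain ⟨e, rfl⟩ : ∃ e, d = e + 1 := ⟨d - 1, by lia⟩
    rw [Nat.add_sub_cancel]
    nlinarith
  | succ x hx ih =>
    rw [pow_succ]
    nlinarith

theorem chainA_le_knuth {k : ℕ} (hd : 2 ≤ d) (hA : ∀ x, 1 ≤ A x)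
    (hle : ∀ x, 2 ≤ x → A x ≤ knuth (d + 1) (k + 1) ((d + 1) ^ x)) {x : ℕ}
    (hx : 2 ≤ x) : chainA A d (d - 1) x ≤ knuth (d + 1) (k + 2 * d) ((d + 1) ^ x) := by
  have ha : 2 ≤ d + 1 := by lia
  refine (chainA_le_iterate_knuth hd hA hle (d - 1) hx).trans ?_
  refine (iterate_knuth_le ha _ _ _).trans ?_
  refine (knuth_monotone ha _ (add_three_mul_le_pow hd hx)).trans ?_
  have h := knuth_le_knuth_level ha (m := k + (d - 1) + 1) (n := k + 2 * d - 1) (by lia)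
    ((d + 1) ^ x)
  rwa [show k + 2 * d - 1 + 1 = k + 2 * d by lia] at h

end Chain

theorem Afun_succ {d : ℕ} (hd : 2 ≤ d) (σ : ℕ) :
    Afun (d + 1) σ = Bfun d (d ^ 2 ^ Bfun d (3 * σ + 4)) := by
  obtain ⟨e, rfl⟩ : ∃ e, d = e + 2 := ⟨d - 2, by lia⟩
  rw [Afun]
  rfl

theorem two_le_pow_two_pow {d : ℕ} (hd : 2 ≤ d) (n : ℕ) : 2 ≤ d ^ 2 ^ n :=
  hd.trans (Nat.le_self_pow (by positivity) d)

theorem one_le_Afun {d : ℕ} (hd : 2 ≤ d) (σ : ℕ) : 1 ≤ Afun d σ := by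
  induction d, hd using Nat.le_induction generalizing σ with
  | base => rw [Afun]; lia
  | succ d hd ih =>
    rw [Afun_succ hd]
    exact le_trans (by lia) (two_le_chainA ih (d - 1) (two_le_pow_two_pow hd _))

theorem three_mul_add_ten_le_pow {a x : ℕ} (ha : 4 ≤ a) (hx : 2 ≤ x) :
    3 * x + 10 ≤ a ^ x := by
  induction x, hx using Nat.le_induction with
  | base => nlinarith
  | succ x hx ih =>
    rw [pow_succ]
    nlinarith

theorem Afun_succ_le_knuth {d k : ℕ} (hd : 2 ≤ d)
    (hB : ∀ x, 2 ≤ x → Bfun d x ≤ knuth (d + 1) (k + 1) ((d + 1) ^ x)) {σ : ℕ} (hσ : 2 ≤ σ) :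
    Afun (d + 1) σ ≤ knuth (d + 2) (k + 2) ((d + 2) ^ σ) := by
  have ha : 2 ≤ d + 2 := by lia
  have hmono := knuth_monotone ha k
  have hB' : ∀ x, 2 ≤ x → Bfun d x ≤ (knuth (d + 2) (k + 1))^[2] x := fun x hx =>
    (hB x hx).trans <| (knuth_le_knuth_base (by lia) (Nat.le_succ _) k _).trans <|
      hmono ((Nat.pow_le_pow_left (Nat.le_succ _) x).trans (pow_le_knuth ha k x))
  have hinner := hB' (3 * σ + 4) (by lia)
  have hexp : d ^ 2 ^ Bfun d (3 * σ + 4) ≤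
      (knuth (d + 2) (k + 1))^[2] (Bfun d (3 * σ + 4)) :=
    (Nat.pow_le_pow_left (by lia) _).trans <| (pow_le_knuth ha k _).trans <|
      hmono ((Nat.pow_le_pow_left ha _).trans (pow_le_knuth ha k _))
  rw [Afun_succ hd]
  refine (hB' _ (two_le_pow_two_pow hd _)).trans ?_
  refine (hmono.iterate 2 (hexp.trans (hmono.iterate 2 hinner))).trans ?_
  refine (iterate_knuth_le ha k 6 (3 * σ + 4)).trans ?_
  exact knuth_monotone ha (k + 1) (three_mul_add_ten_le_pow (by lia) hσ)

theorem Bfun_le_knuth {d k : ℕ} (hd : 2 ≤ d)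
    (hA : ∀ x, 2 ≤ x → Afun d x ≤ knuth (d + 1) (k + 1) ((d + 1) ^ x)) {σ : ℕ} (hσ : 2 ≤ σ) :
    Bfun d σ ≤ knuth (d + 1) (k + 2 * d) ((d + 1) ^ σ) :=
  chainA_le_knuth hd (one_le_Afun hd) hA hσ

theorem Afun_two_le_knuth (σ : ℕ) : Afun 2 σ ≤ knuth 3 1 (3 ^ σ) := by
  have h : ∀ x, 2 * x + 1 ≤ 3 ^ x := fun x => by
    induction x with
    | zero => simp
    | succ x ih => rw [pow_succ]; lia
  rw [Afun, knuth_one_left]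
  have h1 := h σ
  have h2 := h (3 ^ σ)
  lia

theorem Afun_add_two_le_knuth (e : ℕ) {σ : ℕ} (hσ : 2 ≤ σ) :
    Afun (e + 2) σ ≤ knuth (e + 3) (e ^ 2 + 3 * e + 1) ((e + 3) ^ σ) := by
  induction e generalizing σ with
  | zero => exact Afun_two_le_knuth σ
  | succ e ih =>
    have h := Afun_succ_le_knuth (d := e + 2) (k := e ^ 2 + 5 * e + 3) (by lia)
      (fun x hx => (Bfun_le_knuth (by lia) (fun y hy => ih hy) hx).trans_eq (by
        congr 1; ring)) hσ
    refine h.trans_eq ?_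
    congr 1
    ring

/-- For every `d ≥ 2` and `σ ≥ 2`, `A_d σ ≤ (d+1) ↑^(d²-d-1) ((d+1)^σ)` and
`B_d σ ≤ (d+1) ↑^(d²+d-2) ((d+1)^σ)`. -/
theorem Afun_Bfun_le_knuth (d σ : ℕ) (hd : 2 ≤ d) (hσ : 2 ≤ σ) :
    Afun d σ ≤ knuth (d + 1) (d ^ 2 - d - 1) ((d + 1) ^ σ) ∧
    Bfun d σ ≤ knuth (d + 1) (d ^ 2 + d - 2) ((d + 1) ^ σ) := by
  obtain ⟨e, rfl⟩ : ∃ e, d = e + 2 := ⟨d - 2, by lia⟩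
  have hA : (e + 2) ^ 2 - (e + 2) - 1 = e ^ 2 + 3 * e + 1 := by
    have : (e + 2) ^ 2 = e ^ 2 + 4 * e + 4 := by ring
    lia
  have hB : (e + 2) ^ 2 + (e + 2) - 2 = e ^ 2 + 3 * e + 2 * (e + 2) := by
    have : (e + 2) ^ 2 = e ^ 2 + 4 * e + 4 := by ring
    lia
  rw [hA, hB]
  exact ⟨Afun_add_two_le_knuth e hσ,
    Bfun_le_knuth hd (fun x hx => Afun_add_two_le_knuth e hx) hσ⟩
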